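/- arXiv:1910.00958 — 3 statements merged into one kernel-verified Lean document; each statement's English description precedes it below -/
import Mathlib

section
/- Let p ≥ 3 be an integer and λ ∈ ℝ \ {0}. If z ∈ ℂ satisfies f_λ(z) = 0, then z^p is a negative real number; that is, all zeros of f_λ lie on the p rays from the origin at angles (2k+1)π/p, k = 0, 1, …, p−1. -/
open Complex Finset

namespace ZerosOnRays

/-- The shifted sequence `v n i = ∑ k, choose n k * v 0 (i+k)`. -/
noncomputable def vseq (p : ℕ) (w : ℂ) : ℕ → ℕ → ℂ
  | 0, i => if p ∣ i then w ^ (i / p) else 0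
  | n + 1, i => vseq p w n i + vseq p w n (i + 1)

lemma vseq_period (p : ℕ) (hp : 0 < p) (w : ℂ) (n : ℕ) :
    ∀ i, vseq p w n (i + p) = w * vseq p w n i := by
  induction n with
  | zero =>
    intro i
    simp only [vseq, Nat.dvd_add_self_right, Nat.add_div_right _ hp]
    split_ifs
    · rw [pow_succ]; ring
    · simp
  | succ n ih =>
    intro i
    simp only [vseq]
    rw [show i + p + 1 = (i + 1) + p by ring, ih, ih]; ring

/-- Cross product. -/
noncomputable def crs (u v : ℂ) : ℝ := u.re * v.im - u.im * v.re

lemma crs_mul (u w : ℂ) : crs u (w * u) = w.im * (u.re ^ 2 + u.im ^ 2) := by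
  simp [crs]; ring

lemma vseq_crs (p : ℕ) (hp : 2 ≤ p) (w : ℂ) (hw : 0 < w.im) (n : ℕ) :
    ∀ i j, i ≤ j → j ≤ i + p → 0 ≤ crs (vseq p w n i) (vseq p w n j) := by
  have hself : ∀ n i, 0 ≤ crs (vseq p w n i) (vseq p w n (i + p)) := by
    intro n i
    rw [vseq_period p (by omega), crs_mul]
    positivity
  induction n with
  | zero =>
    intro i j hij hji
    rcases Nat.eq_or_lt_of_le hji with h | h
    · rw [h]; exact hself 0 i
    rcases Nat.eq_or_lt_of_le hij with h' | h'
    · subst h'; simp [crs, mul_comm]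
    by_cases h1 : p ∣ i
    · by_cases h2 : p ∣ j
      · exfalso
        have h3 : p ∣ j - i := Nat.dvd_sub h2 h1
        have := Nat.le_of_dvd (by omega) h3
        omega
      · simp [vseq, h2, crs]
    · simp [vseq, h1, crs]
  | succ n ih =>
    intro i j hij hji
    rcases Nat.eq_or_lt_of_le hji with h | h
    · rw [h]; exact hself _ i
    rcases Nat.eq_or_lt_of_le hij with h' | h'
    · subst h'; simp [crs, mul_comm]
    have a1 := ih i j (by omega) (by omega)
    have a2 := ih i (j+1) (by omega) (by omega)
    have a3 := ih (i+1) j (by omega) (by omega)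
    have a4 := ih (i+1) (j+1) (by omega) (by omega)
    simp only [vseq, crs, add_re, add_im] at *
    nlinarith

lemma vseq_ne_zero (p : ℕ) (hp : 2 ≤ p) (w : ℂ) (hw : 0 < w.im) (n : ℕ) :
    vseq p w n 0 ≠ 0 := by
  induction n with
  | zero => simp [vseq]
  | succ n ih =>
    intro h
    apply ih
    simp only [vseq] at h
    have h1 : vseq p w n (0 + 1) = - vseq p w n 0 := by linear_combination h
    have h2 := vseq_crs p hp w hw n (0+1) (0 + p) (by omega) (by omega)
    rw [vseq_period p (by omega), h1] at h2
    have h3 : crs (-vseq p w n 0) (w * vseq p w n 0) = - crs (vseq p w n 0) (w * vseq p w n 0) := by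
      simp [crs]; ring
    rw [h3, crs_mul] at h2
    have h4 : (vseq p w n 0).re ^ 2 + (vseq p w n 0).im ^ 2 ≤ 0 := by
      by_contra hc
      push Not at hc
      have := mul_pos hw hc
      linarith
    apply Complex.ext
    · simp; nlinarith [sq_nonneg (vseq p w n 0).re, sq_nonneg (vseq p w n 0).im]
    · simp; nlinarith [sq_nonneg (vseq p w n 0).re, sq_nonneg (vseq p w n 0).im]

lemma vseq_eq_sum (p : ℕ) (w : ℂ) (n : ℕ) :
    ∀ i, vseq p w n i = ∑ k ∈ range (n + 1), (n.choose k : ℂ) * vseq p w 0 (i + k) := by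
  induction n with
  | zero => intro i; simp
  | succ n ih =>
    intro i
    rw [vseq, ih, ih, Finset.sum_range_succ' _ (n + 1)]
    simp only [Nat.choose_succ_succ, Nat.cast_add, add_mul, Finset.sum_add_distrib]
    have : ∑ k ∈ range (n + 1), (n.choose k : ℂ) * vseq p w 0 (i + k)
        = ∑ k ∈ range (n + 1), (n.choose (k+1) : ℂ) * vseq p w 0 (i + (k + 1))
          + vseq p w 0 i := by
      rw [Finset.sum_range_succ' _ n, Finset.sum_range_succ _ n]
      simp
    rw [this]
    simp only [Nat.succ_eq_add_one, Nat.choose_zero_right, Nat.cast_one, one_mul, add_zero]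
    simp only [show ∀ k, i + 1 + k = i + (k + 1) from fun k => by ring]
    ring

open Polynomial in
/-- The section polynomial. -/
noncomputable def P (p n : ℕ) : Polynomial ℂ :=
  ∑ k ∈ range (n + 1), if p ∣ k then Polynomial.C (n.choose k : ℂ) * Polynomial.X ^ (k / p) else 0

lemma P_eval (p n : ℕ) (w : ℂ) : (P p n).eval w =
    ∑ k ∈ range (n + 1), if p ∣ k then (n.choose k : ℂ) * w ^ (k / p) else 0 := by
  rw [P, Polynomial.eval_finsetSum]
  refine Finset.sum_congr rfl fun k _ => ?_
  split_ifs <;> simp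

lemma P_eval_vseq (p n : ℕ) (w : ℂ) : (P p n).eval w = vseq p w n 0 := by
  rw [P_eval, vseq_eq_sum]
  refine Finset.sum_congr rfl fun k _ => ?_
  simp only [vseq, zero_add]
  split_ifs <;> simp

lemma P_conj (p n : ℕ) (w : ℂ) :
    (P p n).eval ((starRingEnd ℂ) w) = (starRingEnd ℂ) ((P p n).eval w) := by
  rw [P_eval, P_eval, map_sum]
  refine Finset.sum_congr rfl fun k _ => ?_
  split_ifs <;> simp

lemma P_pos (p n : ℕ) (x : ℝ) (hx : 0 ≤ x) : (P p n).eval (x : ℂ) ≠ 0 := by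
  have : (P p n).eval (x : ℂ) =
      ((∑ k ∈ range (n + 1), if p ∣ k then (n.choose k : ℝ) * x ^ (k / p) else 0 : ℝ) : ℂ) := by
    rw [P_eval]
    push_cast
    refine Finset.sum_congr rfl fun k _ => ?_
    split_ifs <;> simp
  rw [this]
  norm_cast
  apply ne_of_gt
  rw [Finset.sum_range_succ']
  have h : 0 ≤ ∑ k ∈ range n, if p ∣ k + 1 then (n.choose (k + 1) : ℝ) * x ^ ((k + 1) / p) else 0 := by
    apply Finset.sum_nonneg
    intro k _
    split_ifs <;> positivity
  simp
  linarith

lemma P_root (p n : ℕ) (hp : 2 ≤ p) (w : ℂ) (h : (P p n).eval w = 0) : w.im = 0 ∧ w.re < 0 := by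
  have h0 : w.im = 0 := by
    rcases lt_trichotomy w.im 0 with h1 | h1 | h1
    · exfalso
      apply vseq_ne_zero p hp ((starRingEnd ℂ) w) (by simpa using h1) n
      rw [← P_eval_vseq, P_conj, h, map_zero]
    · exact h1
    · exfalso
      apply vseq_ne_zero p hp w h1 n
      rw [← P_eval_vseq, h]
  refine ⟨h0, ?_⟩
  by_contra hc
  push Not at hc
  apply P_pos p n w.re hc
  rw [show (w.re : ℂ) = w from Complex.ext (by simp) (by simp [h0]), h]

lemma P_zero (p n : ℕ) (hp : 2 ≤ p) : (P p n).eval 0 = 1 := by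
  rw [P_eval, Finset.sum_range_succ', Finset.sum_eq_zero]
  · simp
  · intro k _
    split_ifs with h
    · have : (k + 1) / p ≠ 0 := by
        have := Nat.le_of_dvd (by omega) h
        have := Nat.div_pos this (by omega)
        omega
      simp [this]
    · rfl

lemma P_deriv (p n : ℕ) (hp : 2 ≤ p) : (P p n).derivative.eval 0 = n.choose p := by
  rw [← Polynomial.coeff_zero_eq_eval_zero, Polynomial.coeff_derivative, P,
    Polynomial.finsetSum_coeff]
  simp only [Nat.cast_zero, zero_add, mul_one]
  have : ∀ k ∈ range (n+1), (if p ∣ k then Polynomial.C (n.choose k : ℂ) * Polynomial.X ^ (k / p)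
      else 0 : Polynomial ℂ).coeff 1 = if k = p then (n.choose p : ℂ) else 0 := by
    intro k _
    by_cases h : p ∣ k
    · obtain ⟨m, rfl⟩ := h
      have hp0 : 0 < p := by omega
      simp only [dvd_mul_right, if_true, Nat.mul_div_cancel_left _ hp0, Polynomial.coeff_C_mul,
        Polynomial.coeff_X_pow]
      by_cases hm : m = 1
      · simp [hm]
      · have : p * m ≠ p := by
          intro h
          apply hm
          exact Nat.eq_of_mul_eq_mul_left hp0 (by simpa using h)
        simp [this, Ne.symm hm]
    · have : k ≠ p := by rintro rfl; exact h dvd_rfl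
      simp [h, this]
  rw [Finset.sum_congr rfl this, Finset.sum_ite_eq']
  split_ifs with h
  · rfl
  · simp at h
    rw [Nat.choose_eq_zero_of_lt (by omega)]; simp

lemma mult_bound (W : ℂ) (K : ℝ) (hK : ∀ x : ℝ, 0 ≤ x → Real.exp (-K * x) ≤ ‖1 + W * x‖)
    (s : Multiset ℂ) : (∀ r ∈ s, r.im = 0 ∧ r.re < 0) →
    Real.exp (-K * (s.map fun r => 1 / (0 - r)).sum.re) * ‖(s.map fun r => 0 - r).prod‖
      ≤ ‖(s.map fun r => W - r).prod‖ := by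
  induction s using Multiset.induction_on with
  | empty => simp
  | cons r s ih =>
    intro h
    have ih' := ih fun r hr => h r (Multiset.mem_cons_of_mem hr)
    obtain ⟨h1, h2⟩ := h r (Multiset.mem_cons_self r s)
    obtain ⟨x, hx, rfl⟩ : ∃ x : ℝ, 0 < x ∧ r = -(x : ℂ)⁻¹ := by
      refine ⟨(-r.re)⁻¹, by simpa using h2, ?_⟩
      apply Complex.ext
      · rw [← ofReal_inv]; simp
      · rw [← ofReal_inv]; simp [h1]
    have hx' : (x : ℂ) ≠ 0 := by exact_mod_cast hx.ne'
    simp only [Multiset.map_cons, Multiset.sum_cons, Multiset.prod_cons, norm_mul, add_re]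
    have e1 : (1 / (0 - -(x : ℂ)⁻¹)) = x := by simp
    have e2 : (W - -(x : ℂ)⁻¹) = (1 + W * x) * (0 - -(x : ℂ)⁻¹) := by field_simp; ring
    rw [e1, e2, norm_mul, ofReal_re, mul_add, Real.exp_add]
    have := hK x hx.le
    calc _ = (Real.exp (-K * x) * ‖0 - -(x : ℂ)⁻¹‖) * (Real.exp (-K * (s.map fun r => 1 / (0 - r)).sum.re) * ‖(s.map fun r => 0 - r).prod‖) := by ring
      _ ≤ _ := by gcongr

lemma P_lower (p n : ℕ) (hp : 2 ≤ p) (W : ℂ) (K : ℝ)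
    (hK : ∀ x : ℝ, 0 ≤ x → Real.exp (-K * x) ≤ ‖1 + W * x‖) :
    Real.exp (-K * n.choose p) ≤ ‖(P p n).eval W‖ := by
  have hs : (P p n).Splits := IsAlgClosed.splits _
  have h0 := P_zero p n hp
  have hne : P p n ≠ 0 := by
    intro h; rw [h] at h0; simp at h0
  have hb := mult_bound W K hK (P p n).roots (by
    intro r hr
    exact P_root p n hp r ((Polynomial.mem_roots hne).1 hr))
  have hd := hs.eval_derivative_div_eval_of_ne_zero (x := 0) (by rw [h0]; simp)
  rw [P_deriv p n hp, h0, div_one] at hd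
  rw [← hd] at hb
  have e0 := hs.eval_eq_prod_roots 0
  rw [h0] at e0
  rw [hs.eval_eq_prod_roots W, norm_mul]
  have e0' := congrArg norm e0
  rw [norm_mul, norm_one] at e0'
  rw [natCast_re] at hb
  calc _ = Real.exp (-K * n.choose p) * (‖(P p n).leadingCoeff‖ * ‖((P p n).roots.map fun r => 0 - r).prod‖) := by
        rw [← e0', mul_one]
    _ = ‖(P p n).leadingCoeff‖ * (Real.exp (-K * n.choose p) * ‖((P p n).roots.map fun r => 0 - r).prod‖) := by ring
    _ ≤ _ := by gcongr

lemma exists_K (w : ℂ) (hw : ¬ (w.im = 0 ∧ w.re < 0)) :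
    ∃ K : ℝ, 0 ≤ K ∧ ∀ x : ℝ, 0 ≤ x → Real.exp (-K * x) ≤ ‖1 + w * x‖ := by
  obtain ⟨c, hc, hc1, hcx⟩ : ∃ c : ℝ, 0 < c ∧ c ≤ 1 ∧ ∀ x : ℝ, 0 ≤ x → c ≤ ‖1 + w * x‖ := by
    by_cases him : w.im = 0
    · have hre : 0 ≤ w.re := by
        by_contra h; exact hw ⟨him, by linarith⟩
      refine ⟨1, one_pos, le_rfl, fun x hx => ?_⟩
      have := Complex.re_le_norm (1 + w * x)
      simp at this
      have := mul_nonneg hre hx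
      linarith
    · have hw0 : w ≠ 0 := by rintro rfl; simp at him
      have hn : 0 < ‖w‖ := norm_pos_iff.2 hw0
      refine ⟨|w.im| / ‖w‖, by positivity, ?_, fun x hx => ?_⟩
      · rw [div_le_one hn]; exact Complex.abs_im_le_norm w
      · rw [div_le_iff₀ hn]
        have := Complex.abs_im_le_norm ((1 + w * x) * (starRingEnd ℂ) w)
        rw [norm_mul, Complex.norm_conj] at this
        refine le_trans (le_of_eq ?_) this
        rw [← abs_neg]
        congr 1
        simp; ring
  have hl : 0 ≤ - Real.log c := by
    have := Real.log_nonpos hc.le hc1; linarith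
  refine ⟨2 * ‖w‖ * (-Real.log c) + 2 * ‖w‖, by positivity, fun x hx => ?_⟩
  by_cases ht : ‖w‖ * x ≤ 1 / 2
  · have h1 : 1 - ‖w‖ * x ≤ ‖1 + w * x‖ := by
      have := norm_sub_le (1 + w * x) (w * x)
      rw [add_sub_cancel_right, norm_one, norm_mul, Complex.norm_real, Real.norm_of_nonneg hx] at this
      linarith
    refine le_trans ?_ h1
    set t := ‖w‖ * x with ht'
    have ht0 : 0 ≤ t := by positivity
    have h2 : Real.exp (-(2 * ‖w‖ * (-Real.log c) + 2 * ‖w‖) * x) ≤ Real.exp (-(2 * t)) := by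
      apply Real.exp_le_exp.2
      have : 0 ≤ t * (-Real.log c) := by positivity
      rw [ht'] at *
      nlinarith
    refine h2.trans ?_
    rw [Real.exp_neg, inv_le_comm₀ (Real.exp_pos _) (by linarith)]
    have := Real.add_one_le_exp (2 * t)
    refine le_trans ?_ this
    rw [inv_le_iff_one_le_mul₀ (by linarith)]
    nlinarith
  · push Not at ht
    refine le_trans ?_ (hcx x hx)
    conv_rhs => rw [← Real.exp_log hc]
    apply Real.exp_le_exp.2
    have : 0 ≤ ‖w‖ * x := by positivity
    nlinarith

lemma filter_sum (p n : ℕ) (hp : 2 ≤ p) (ω : ℂ) (hω : IsPrimitiveRoot ω p) (x : ℂ) :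
    ∑ k ∈ range p, (1 + ω ^ k * x) ^ n = p * (P p n).eval (x ^ p) := by
  have h1 : ∀ m, ∑ k ∈ range p, (ω ^ k) ^ m = if p ∣ m then (p : ℂ) else 0 := by
    intro m
    simp only [← pow_mul, mul_comm _ m]
    simp only [pow_mul]
    split_ifs with h
    · rw [(hω.pow_eq_one_iff_dvd m).2 h]; simp
    · have hne : ω ^ m ≠ 1 := fun h' => h ((hω.pow_eq_one_iff_dvd m).1 h')
      rw [geom_sum_eq hne, ← pow_mul, mul_comm m p, pow_mul, hω.pow_eq_one]; simp
  have h2 : ∀ k ∈ range p, (1 + ω ^ k * x) ^ n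
      = ∑ m ∈ range (n + 1), (ω ^ k) ^ m * (x ^ m * n.choose m) := by
    intro k _
    rw [add_comm, add_pow]
    refine Finset.sum_congr rfl fun m _ => ?_
    rw [mul_pow]; simp; ring
  rw [Finset.sum_congr rfl h2, Finset.sum_comm, P_eval, Finset.mul_sum]
  refine Finset.sum_congr rfl fun m _ => ?_
  rw [← Finset.sum_mul, h1]
  split_ifs with h
  · rw [← pow_mul, Nat.mul_div_cancel' h]; ring
  · simp

lemma main_aux (p : ℕ) (hp : 2 ≤ p) (ω : ℂ) (hω : IsPrimitiveRoot ω p) (z : ℂ)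
    (hz : ∑ k ∈ range p, Complex.exp (ω ^ k * z) = 0) : (z ^ p).im = 0 ∧ (z ^ p).re < 0 := by
  by_contra hc
  obtain ⟨K, hK0, hK⟩ := exists_K (z ^ p) hc
  have hlim : Filter.Tendsto (fun n : ℕ => ‖∑ k ∈ range p, (1 + ω ^ k * z / n) ^ n‖) Filter.atTop
      (nhds ‖∑ k ∈ range p, Complex.exp (ω ^ k * z)‖) := by
    apply Filter.Tendsto.norm
    apply tendsto_finsetSum
    intro k _
    exact Complex.tendsto_one_add_div_pow_exp _
  rw [hz, norm_zero] at hlim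
  have hlow : ∀ n : ℕ, 1 ≤ n → Real.exp (-K) ≤ ‖∑ k ∈ range p, (1 + ω ^ k * z / n) ^ n‖ := by
    intro n hn
    have hn0 : (0 : ℝ) < n := by exact_mod_cast hn
    simp only [mul_div_assoc]
    rw [filter_sum p n hp ω hω, norm_mul, div_pow]
    have hb := P_lower p n hp (z ^ p / (n : ℂ) ^ p) (K / (n : ℝ) ^ p) (by
      intro x hx
      have := hK (x / (n : ℝ) ^ p) (by positivity)
      push_cast at this
      convert this using 2
      · ring
      · ring)
    have h1 : (n.choose p : ℝ) ≤ (n : ℝ) ^ p := by exact_mod_cast Nat.choose_le_pow n p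
    have h2 : Real.exp (-K) ≤ Real.exp (-(K / (n : ℝ) ^ p) * n.choose p) := by
      apply Real.exp_le_exp.2
      have : K / (n : ℝ) ^ p * n.choose p ≤ K / (n : ℝ) ^ p * (n : ℝ) ^ p := by gcongr
      rw [div_mul_cancel₀ _ (by positivity)] at this
      linarith
    have h3 : (1 : ℝ) ≤ ‖(p : ℂ)‖ := by
      rw [Complex.norm_natCast]; exact_mod_cast (by omega : 1 ≤ p)
    refine (h2.trans hb).trans ?_
    exact le_mul_of_one_le_left (norm_nonneg _) h3
  have := ge_of_tendsto hlim (Filter.eventually_atTop.2 ⟨1, hlow⟩)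
  have := Real.exp_pos (-K)
  linarith

end ZerosOnRays

theorem f_lambda_zeros_on_rays (p : ℕ) (hp : 3 ≤ p) (lam : ℝ) (hlam : lam ≠ 0)
    (f : ℂ → ℂ)
    (hf : ∀ z : ℂ, f z = lam * ∑ k ∈ Finset.range p,
      Complex.exp ((Complex.exp (2 * Real.pi * Complex.I / p)) ^ k * z))
    (z : ℂ) (hz : f z = 0) : ∃ r : ℝ, r < 0 ∧ z ^ p = (r : ℂ) := by
  rw [hf] at hz
  have h1 := (mul_eq_zero.1 hz).resolve_left (by exact_mod_cast hlam)
  obtain ⟨h2, h3⟩ := ZerosOnRays.main_aux p (by omega) _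
    (Complex.isPrimitiveRoot_exp p (by omega)) z h1
  exact ⟨(z ^ p).re, h3, Complex.ext (by simp) (by simp [h2])⟩
end

section
/- Let p ≥ 3 be an integer, λ ∈ ℝ \ {0}, and let θ = (2k+1)π/p for some k ∈ {0, 1, …, p−1}. If 0 < t₁ < t₂ and both t₁e^{iθ} and t₂e^{iθ} are critical points of f_λ, then there exists t ∈ (t₁, t₂) with f_λ(t e^{iθ}) = 0; that is, on each of these rays, distinct critical points of f_λ are separated by zeros of f_λ. -/
open Complex Finset

/-- A cooperative (differential inequality) system with nonnegative initial data stays nonnegative. -/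
theorem coop_nonneg {ι : Type*} (u u' : ι → ℝ → ℝ) (T B : ℝ)
    (hd : ∀ i t, HasDerivAt (u i) (u' i t) t)
    (h0 : ∀ i, 0 ≤ u i 0)
    (hb : ∀ i t, 0 ≤ t → t ≤ T → -B ≤ u i t)
    (hc : ∀ i t c, 0 ≤ t → 0 ≤ c → (∀ j, -c ≤ u j t) → -(2 * c) ≤ u' i t)
    (hB : 0 ≤ B) (i : ι) (t : ℝ) (ht : 0 ≤ t) (htT : t ≤ T) : 0 ≤ u i t := by
  have key : ∀ n : ℕ, ∀ i t, 0 ≤ t → t ≤ T → -(B * ((2 * t) ^ n / n.factorial)) ≤ u i t := by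
    intro n
    induction n with
    | zero => intro i t h1 h2; simpa using hb i t h1 h2
    | succ n ih =>
      intro i t h1 h2
      have hder : ∀ s : ℝ, HasDerivAt (fun s => u i s + B * ((2 * s) ^ (n+1) / (n+1).factorial))
          (u' i s + 2 * (B * ((2 * s) ^ n / n.factorial))) s := by
        intro s
        have h3 := ((((hasDerivAt_id s).const_mul 2).pow (n+1)).div_const
          ((n+1).factorial : ℝ)).const_mul B
        refine ((hd i s).add h3).congr_deriv ?_
        have : (n.factorial : ℝ) ≠ 0 := by positivity
        have h4 : (n + 1 : ℝ) ≠ 0 := by positivity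
        simp only [Nat.factorial_succ, id]
        push_cast
        field_simp
      have hm : MonotoneOn (fun s => u i s + B * ((2 * s) ^ (n+1) / (n+1).factorial))
          (Set.Icc 0 T) := by
        apply monotoneOn_of_deriv_nonneg (convex_Icc 0 T)
        · exact fun s _ => (hder s).continuousAt.continuousWithinAt
        · exact fun s _ => (hder s).differentiableAt.differentiableWithinAt
        · intro s hs
          rw [interior_Icc] at hs
          rw [(hder s).deriv]
          have hs0 : 0 ≤ s := hs.1.le
          have := hc i s (B * ((2 * s) ^ n / n.factorial)) hs0 (by positivity)
            (fun j => ih j s hs0 hs.2.le)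
          linarith
      have h5 := hm (Set.left_mem_Icc.2 (h1.trans h2)) ⟨h1, h2⟩ h1
      have h6 := h0 i
      simp at h5
      linarith
  have hl : Filter.Tendsto (fun n : ℕ => -(B * ((2 * t) ^ n / n.factorial))) Filter.atTop
      (nhds (-(B * 0))) :=
    ((FloorSemiring.tendsto_pow_div_factorial_atTop (2 * t)).const_mul B).neg
  have := le_of_tendsto' hl (fun n => key n i t ht htT)
  simpa using this

/-- The abstract real argument. -/
theorem laguerre_pos (p : ℕ) (hp : 3 ≤ p) (y : ℕ → ℝ → ℝ)
    (hd : ∀ j t, HasDerivAt (y j) (y (j+1) t) t)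
    (hper : ∀ j t, y (j + p) t = - y j t)
    (hbd : ∀ j t, |y j t| ≤ p * Real.exp |t|)
    (hz : ∀ j, ¬ p ∣ j → y j 0 = 0) (h00 : y 0 0 = p) (t : ℝ) (ht : 0 < t) :
    0 < y 1 t ^ 2 - y 0 t * y 2 t := by
  set b : ℕ → ℕ → ℝ → ℝ := fun i j t => y (i+1) t * y j t - y i t * y (j+1) t with hb
  have hbd' : ∀ i j s, HasDerivAt (b i j) (b (i+1) j s + b i (j+1) s) s := by
    intro i j s
    refine (((hd (i+1) s).mul (hd j s)).sub ((hd i s).mul (hd (j+1) s))).congr_deriv ?_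
    simp only [hb]; ring
  have hb1 : ∀ i s, b i i s = 0 := by intro i s; simp only [hb]; ring
  have hb2 : ∀ i s, b i (i+p) s = 0 := by
    intro i s; simp only [hb]
    rw [hper, show i + p + 1 = i + 1 + p by ring, hper]; ring
  have hinit : ∀ i j, i ≤ j → j ≤ i + p → 0 ≤ b i j 0 := by
    intro i j h1 h2
    rcases Nat.eq_or_lt_of_le h1 with h | h1
    · subst h; rw [hb1]
    rcases Nat.eq_or_lt_of_le h2 with h | h2
    · subst h; rw [hb2]
    have e1 : 0 ≤ y (i+1) 0 * y j 0 := by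
      by_cases ha : p ∣ i + 1
      · by_cases hb : p ∣ j
        · have h3 : p ∣ j - (i+1) := Nat.dvd_sub hb ha
          have h4 := Nat.eq_zero_of_dvd_of_lt h3 (by omega)
          have : j = i + 1 := by omega
          subst this; exact mul_self_nonneg _
        · rw [hz j hb]; simp
      · rw [hz _ ha]; simp
    have e2 : y i 0 * y (j+1) 0 ≤ 0 := by
      by_cases ha : p ∣ i
      · by_cases hb : p ∣ j + 1
        · have h3 : p ∣ (i + p) - (j + 1) := Nat.dvd_sub (ha.add (dvd_refl p)) hb
          have h4 := Nat.eq_zero_of_dvd_of_lt h3 (by omega)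
          have : j + 1 = i + p := by omega
          rw [this, hper]; nlinarith [mul_self_nonneg (y i 0)]
        · rw [hz _ hb]; simp
      · rw [hz _ ha]; simp
    simp only [hb]; linarith
  have hnn : ∀ i j, i ≤ j → j ≤ i + p → ∀ s, 0 ≤ s → 0 ≤ b i j s := by
    intro i j h1 h2 s hs
    refine coop_nonneg (ι := {q : ℕ × ℕ // q.1 ≤ q.2 ∧ q.2 ≤ q.1 + p})
      (fun q => b q.1.1 q.1.2)
      (fun q s => b (q.1.1+1) q.1.2 s + b q.1.1 (q.1.2+1) s) s
      (2 * (p * Real.exp s) ^ 2) (fun q r => hbd' _ _ r)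
      (fun q => hinit _ _ q.2.1 q.2.2) ?_ ?_ (by positivity) ⟨(i, j), h1, h2⟩ s hs le_rfl
    · rintro ⟨⟨i, j⟩, h1, h2⟩ r hr hrs
      have hy : ∀ k, |y k r| ≤ p * Real.exp s := by
        intro k
        refine (hbd k r).trans ?_
        rw [abs_of_nonneg hr]
        gcongr
      have hprod : ∀ k l, |y k r * y l r| ≤ (p * Real.exp s) ^ 2 := by
        intro k l
        rw [abs_mul, sq]
        exact mul_le_mul (hy k) (hy l) (abs_nonneg _) (by positivity)
      have a1 := abs_le.1 (hprod (i+1) j)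
      have a2 := abs_le.1 (hprod i (j+1))
      simp only [hb]
      linarith [a1.1, a2.2]
    · rintro ⟨⟨i, j⟩, h1, h2⟩ r c hr hc hall
      simp only at h1 h2 ⊢
      rcases Nat.eq_or_lt_of_le h1 with h | h1
      · subst h
        have : b (i+1) i r + b i (i+1) r = 0 := by simp only [hb]; ring
        rw [this]; linarith
      rcases Nat.eq_or_lt_of_le h2 with h | h2
      · subst h
        have : b (i+1) (i+p) r + b i (i+p+1) r = 0 := by
          simp only [hb]
          rw [show i + p + 1 + 1 = i + 2 + p by ring, show i + p + 1 = i + 1 + p by ring]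
          simp only [hper]; ring
        rw [this]; linarith
      have a1 := hall ⟨(i+1, j), by simp only; omega, by simp only; omega⟩
      have a2 := hall ⟨(i, j+1), by simp only; omega, by simp only; omega⟩
      simp only at a1 a2
      linarith
  have hpos : ∀ m : ℕ, m + 2 ≤ p → ∀ s, 0 < s → 0 < b 0 (p - 1 - m) s := by
    intro m
    induction m with
    | zero =>
      intro _ s hs
      have hm : MonotoneOn (b 0 (p-1-0)) (Set.Ici 0) := by
        apply monotoneOn_of_deriv_nonneg (convex_Ici 0)
        · exact fun s _ => (hbd' _ _ s).continuousAt.continuousWithinAt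
        · exact fun s _ => (hbd' _ _ s).differentiableAt.differentiableWithinAt
        · intro r hr
          rw [interior_Ici] at hr
          rw [(hbd' _ _ r).deriv]
          exact add_nonneg (hnn _ _ (by omega) (by omega) r (le_of_lt hr))
            (hnn _ _ (by omega) (by omega) r (le_of_lt hr))
      have h1 := hm (Set.mem_Ici.2 le_rfl) (Set.mem_Ici.2 hs.le) hs.le
      refine lt_of_lt_of_le ?_ h1
      have h2 : y 1 0 = 0 := hz 1 (by
        intro h; have := Nat.le_of_dvd one_pos h; omega)
      have h3 : y p 0 = - p := by have := hper 0 0; rw [zero_add, h00] at this; exact this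
      simp only [hb]
      rw [show p - 1 - 0 + 1 = p by omega, h3, h00, zero_add, h2]
      have : (0:ℝ) < p := by exact_mod_cast (by omega : 0 < p)
      nlinarith
    | succ m ih =>
      intro hm2 s hs
      have hm : StrictMonoOn (b 0 (p-1-(m+1))) (Set.Ici 0) := by
        apply strictMonoOn_of_deriv_pos (convex_Ici 0)
        · exact fun s _ => (hbd' _ _ s).continuousAt.continuousWithinAt
        · intro r hr
          rw [interior_Ici] at hr
          rw [(hbd' _ _ r).deriv]
          have h4 := ih (by omega) r hr
          rw [show p - 1 - (m+1) + 1 = p - 1 - m by omega]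
          exact add_pos_of_nonneg_of_pos
            (hnn _ _ (by omega) (by omega) r (le_of_lt hr)) h4
      have h1 := hm (Set.mem_Ici.2 le_rfl) (Set.mem_Ici.2 hs.le) hs
      exact lt_of_le_of_lt (hinit _ _ (by omega) (by omega)) h1
  have := hpos (p - 2) (by omega) t ht
  rw [show p - 1 - (p - 2) = 1 by omega] at this
  simp only [hb] at this
  norm_num at this
  nlinarith

theorem f_lambda_critical_points_separated_by_zeros (p : ℕ) (hp : 3 ≤ p)
    (lam : ℝ) (hlam : lam ≠ 0)
    (f : ℂ → ℂ)
    (hf : ∀ z : ℂ, f z = lam * ∑ k ∈ Finset.range p,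
      Complex.exp ((Complex.exp (2 * Real.pi * Complex.I / p)) ^ k * z))
    (k : ℕ) (hk : k < p) (θ : ℝ) (hθ : θ = (2 * k + 1) * Real.pi / p)
    (t₁ t₂ : ℝ) (ht₁ : 0 < t₁) (ht : t₁ < t₂)
    (hc₁ : deriv f (t₁ * Complex.exp (θ * Complex.I)) = 0)
    (hc₂ : deriv f (t₂ * Complex.exp (θ * Complex.I)) = 0) :
    ∃ t ∈ Set.Ioo t₁ t₂, f (t * Complex.exp (θ * Complex.I)) = 0 := by
  have hp0 : p ≠ 0 := by omega
  have hpC : (p : ℂ) ≠ 0 := by exact_mod_cast hp0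
  set ω := Complex.exp (2 * Real.pi * Complex.I / p) with hω
  set e := Complex.exp (θ * Complex.I) with he
  have hprim : IsPrimitiveRoot ω p := Complex.isPrimitiveRoot_exp p hp0
  have hep : e ^ p = -1 := by
    rw [he, ← Complex.exp_nat_mul, hθ]
    push_cast
    rw [show (p : ℂ) * ((2 * k + 1) * Real.pi / p * I) = Real.pi * I + k * (2 * Real.pi * I) by
      field_simp; ring]
    rw [Complex.exp_add, Complex.exp_pi_mul_I, Complex.exp_nat_mul_two_pi_mul_I, mul_one]
  have hωn : ‖ω‖ = 1 := hprim.norm'_eq_one hp0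
  have hen : ‖e‖ = 1 := Complex.norm_exp_ofReal_mul_I θ
  -- the derivatives along the ray
  set Y : ℕ → ℝ → ℂ := fun j t => ∑ k ∈ range p, (ω ^ k * e) ^ j * Complex.exp (ω ^ k * e * t)
    with hY
  have hYd : ∀ j t, HasDerivAt (Y j) (Y (j+1) t) t := by
    intro j t
    simp only [hY]
    apply HasDerivAt.fun_sum
    intro l _
    have h1 : HasDerivAt (fun t : ℝ => ω ^ l * e * (t : ℂ)) (ω ^ l * e * 1) t :=
      (Complex.ofRealCLM.hasDerivAt (x := t)).const_mul _
    refine (h1.cexp.const_mul _).congr_deriv ?_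
    rw [pow_succ]; ring
  have hYper : ∀ j t, Y (j + p) t = - Y j t := by
    intro j t
    simp only [hY]
    rw [← Finset.sum_neg_distrib]
    refine Finset.sum_congr rfl fun l _ => ?_
    rw [pow_add, mul_pow _ _ p, ← pow_mul, mul_comm l p, pow_mul, hprim.pow_eq_one, hep]
    simp
  have hYb : ∀ j t, ‖Y j t‖ ≤ p * Real.exp |t| := by
    intro j t
    simp only [hY]
    refine (norm_sum_le_of_le (range p) (f := fun k => (ω ^ k * e) ^ j * Complex.exp (ω ^ k * e * t))
      (n := fun _ => Real.exp |t|) fun l _ => ?_).trans ?_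
    · rw [norm_mul, norm_pow, norm_mul, norm_pow, hωn, hen]
      simp only [one_pow, mul_one, one_mul]
      refine (Complex.norm_exp_le_exp_norm _).trans ?_
      rw [norm_mul, norm_mul, norm_pow, hωn, hen]
      simp
    · simp
  have hYz : ∀ j, ¬ p ∣ j → Y j 0 = 0 := by
    intro j hj
    have h1 : ω ^ j ≠ 1 := fun h => hj ((hprim.pow_eq_one_iff_dvd j).1 h)
    have h2 : Y j 0 = (∑ k ∈ range p, (ω ^ j) ^ k) * e ^ j := by
      simp only [hY, Finset.sum_mul]
      refine Finset.sum_congr rfl fun l _ => ?_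
      rw [mul_pow, ← pow_mul, ← pow_mul, mul_comm l j]; simp
    rw [h2, geom_sum_eq h1, ← pow_mul, mul_comm j p, pow_mul, hprim.pow_eq_one]
    simp
  have hY0 : Y 0 0 = p := by simp [hY]
  have hYim0 : ∀ j, (Y j 0).im = 0 := by
    intro j
    by_cases hj : p ∣ j
    · obtain ⟨m, rfl⟩ := hj
      induction m with
      | zero => simp [hY0]
      | succ m ih => rw [Nat.mul_succ, hYper, Complex.neg_im, ih, neg_zero]
    · rw [hYz j hj]; simp
  have hre : ∀ j t, HasDerivAt (fun t => (Y j t).re) (Y (j+1) t).re t := fun j t =>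
    Complex.reCLM.hasFDerivAt.comp_hasDerivAt t (hYd j t)
  have him : ∀ j t, HasDerivAt (fun t => (Y j t).im) (Y (j+1) t).im t := fun j t =>
    Complex.imCLM.hasFDerivAt.comp_hasDerivAt t (hYd j t)
  have himb : ∀ T j t, 0 ≤ t → t ≤ T → |(Y j t).im| ≤ p * Real.exp T := by
    intro T j t h1 h2
    refine ((Complex.abs_im_le_norm _).trans (hYb j t)).trans ?_
    rw [abs_of_nonneg h1]; gcongr
  have him0 : ∀ j t, 0 ≤ t → (Y j t).im = 0 := by
    intro j t h0
    apply le_antisymm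
    · have := coop_nonneg (fun j t => -(Y j t).im) (fun j t => -(Y (j+1) t).im) t (p * Real.exp t)
        (fun j t => (him j t).neg) (fun j => by simp [hYim0])
        (fun j s h1 h2 => by have := (abs_le.1 (himb t j s h1 h2)).2; linarith)
        (fun j s c _ hc h => by have := h (j+1); linarith)
        (by positivity) j t h0 le_rfl
      linarith
    · exact coop_nonneg (fun j t => (Y j t).im) (fun j t => (Y (j+1) t).im) t (p * Real.exp t)
        (fun j t => (him j t)) (fun j => by simp [hYim0])
        (fun j s h1 h2 => by have := (abs_le.1 (himb t j s h1 h2)).1; linarith)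
        (fun j s c _ hc h => by have := h (j+1); linarith)
        (by positivity) j t h0 le_rfl
  have hL : ∀ t, 0 < t → 0 < (Y 1 t).re ^ 2 - (Y 0 t).re * (Y 2 t).re := fun t ht =>
    laguerre_pos p hp (fun j t => (Y j t).re) hre (fun j t => by simp [hYper])
      (fun j t => (Complex.abs_re_le_norm _).trans (hYb j t))
      (fun j hj => by simp [hYz j hj]) (by simp [hY0]) t ht
  have hfY : ∀ t : ℝ, f (t * e) = lam * Y 0 t := by
    intro t
    rw [hf]; simp only [hY]
    congr 1
    refine Finset.sum_congr rfl fun l _ => ?_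
    rw [pow_zero, one_mul]; congr 1; ring
  have hcrit : ∀ t : ℝ, deriv f (t * e) = 0 → (Y 1 t).re = 0 := by
    intro t h
    have h1 : HasDerivAt f (lam * ∑ k ∈ range p, ω ^ k * Complex.exp (ω ^ k * (t * e))) (t * e) := by
      rw [funext hf]
      refine HasDerivAt.const_mul _ (HasDerivAt.fun_sum fun l _ => ?_)
      refine (((hasDerivAt_id (t * e : ℂ)).const_mul (ω ^ l)).cexp).congr_deriv ?_
      simp only [id]; ring
    rw [h1.deriv] at h
    have h2 := (mul_eq_zero.1 h).resolve_left (by exact_mod_cast hlam)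
    have h3 : Y 1 t = e * ∑ k ∈ range p, ω ^ k * Complex.exp (ω ^ k * (t * e)) := by
      simp only [hY, Finset.mul_sum]
      refine Finset.sum_congr rfl fun l _ => ?_
      rw [pow_one, show ω ^ l * e * (t : ℂ) = ω ^ l * (t * e) by ring]; ring
    rw [h3, h2]; simp
  have h1 := hcrit t₁ hc₁
  have h2 := hcrit t₂ hc₂
  by_contra hno
  push Not at hno
  have hne : ∀ t ∈ Set.Icc t₁ t₂, (Y 0 t).re ≠ 0 := by
    intro t htt h0
    have htp : 0 < t := lt_of_lt_of_le ht₁ htt.1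
    rcases eq_or_lt_of_le htt.1 with h | ha
    · have := hL t htp
      rw [h0, ← h, h1] at this; simp at this
    rcases eq_or_lt_of_le htt.2 with h | hb
    · have := hL t htp
      rw [h0, h, h2] at this; simp at this
    apply hno t ⟨ha, hb⟩
    rw [hfY, Complex.ext (z := Y 0 t) (w := 0) h0 (him0 0 t htp.le), mul_zero]
  have hq : ∀ t ∈ Set.Icc t₁ t₂, HasDerivAt (fun t => (Y 1 t).re / (Y 0 t).re)
      (((Y 2 t).re * (Y 0 t).re - (Y 1 t).re * (Y 1 t).re) / (Y 0 t).re ^ 2) t :=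
    fun t htt => (hre 1 t).div (hre 0 t) (hne t htt)
  obtain ⟨c, hc, hc0⟩ := exists_hasDerivAt_eq_zero ht
    (fun t htt => (hq t htt).continuousAt.continuousWithinAt) (by simp [h1, h2])
    (fun t htt => hq t (Set.Ioo_subset_Icc_self htt))
  have hcp := hL c (ht₁.trans hc.1)
  have hcn := hne c (Set.Ioo_subset_Icc_self hc)
  rcases div_eq_zero_iff.1 hc0 with h | h
  · nlinarith
  · exact hcn (pow_eq_zero_iff (two_ne_zero) |>.1 h)
end

section
/- Let p ≥ 3 be an integer and λ ∈ ℝ \ {0}. If z ∈ ℂ is a critical point of f_λ (i.e. f_λ'(z) = 0), then the critical value f_λ(z) is a real number. -/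
open Complex Finset

/-- Discrete positivity of the cyclic Wronskian-type forms. -/
lemma flam_discrete (p : ℕ) (Z : ℂ) (h : ℝ) (hh : 0 ≤ h) (v : ℕ → ℤ → ℂ)
    (hrec : ∀ n r, v (n + 1) r = v n r + h * v n (r - 1))
    (hper : ∀ n r, v n (r - p) = Z * v n r)
    (h0 : ∀ r s : ℤ, r < s → s < r + p → Z.im * (v 0 r * (starRingEnd ℂ) (v 0 s)).im = 0)
    (n : ℕ) : ∀ r s : ℤ, r ≤ s → s ≤ r + p →
      0 ≤ Z.im * (v n r * (starRingEnd ℂ) (v n s)).im := by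
  have hdiag : ∀ n (r : ℤ), 0 ≤ Z.im * (v n r * (starRingEnd ℂ) (v n r)).im := by
    intro n r
    rw [Complex.mul_conj]; simp
  have hfull : ∀ n (r : ℤ), 0 ≤ Z.im * (v n r * (starRingEnd ℂ) (v n (r + p))).im := by
    intro n r
    have := hper n (r + p)
    rw [add_sub_cancel_right] at this
    rw [this, mul_assoc, Complex.mul_conj, Complex.im_mul_ofReal, ← mul_assoc]
    exact mul_nonneg (mul_self_nonneg _) (Complex.normSq_nonneg _)
  induction n with
  | zero =>
    intro r s h1 h2
    rcases h1.eq_or_lt with rfl | h1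
    · exact hdiag _ _
    rcases h2.eq_or_lt with rfl | h2
    · exact hfull _ _
    exact (h0 r s h1 h2).ge
  | succ n ih =>
    intro r s h1 h2
    rcases h1.eq_or_lt with rfl | h1
    · exact hdiag _ _
    rcases h2.eq_or_lt with rfl | h2
    · exact hfull _ _
    have a1 := ih r s h1.le h2.le
    have a2 := ih (r - 1) s (by lia) (by lia)
    have a3 := ih r (s - 1) (by lia) (by lia)
    have a4 := ih (r - 1) (s - 1) (by lia) (by lia)
    have e : Z.im * (v (n + 1) r * (starRingEnd ℂ) (v (n + 1) s)).im
      = Z.im * (v n r * (starRingEnd ℂ) (v n s)).im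
        + h * (Z.im * (v n (r - 1) * (starRingEnd ℂ) (v n s)).im)
        + h * (Z.im * (v n r * (starRingEnd ℂ) (v n (s - 1))).im)
        + h * h * (Z.im * (v n (r - 1) * (starRingEnd ℂ) (v n (s - 1))).im) := by
      rw [hrec, hrec]
      simp only [Complex.mul_im, Complex.add_re, Complex.add_im, Complex.conj_re, Complex.conj_im,
        Complex.mul_re, Complex.ofReal_re, Complex.ofReal_im]
      ring
    rw [e]
    positivity

lemma flam_sum_zero (p : ℕ) (w : ℂ) (hw : IsPrimitiveRoot w p) (r : ℤ) (hr : ¬ (p : ℤ) ∣ r) (z : ℂ) :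
    ∑ k ∈ Finset.range p, (w ^ k * z) ^ (-r) = 0 := by
  have hx : w ^ (-r) ≠ 1 := by
    rw [Ne, hw.zpow_eq_one_iff_dvd]; simpa using hr
  have e : ∀ k ∈ Finset.range p, (w ^ k * z) ^ (-r) = (w ^ (-r)) ^ k * z ^ (-r) := by
    intro k _
    rw [mul_zpow, ← zpow_natCast, ← zpow_natCast, ← zpow_mul, ← zpow_mul, mul_comm (k : ℤ)]
  rw [Finset.sum_congr rfl e, ← Finset.sum_mul, geom_sum_eq hx]
  have : (w ^ (-r)) ^ p = 1 := by
    rw [← zpow_natCast, ← zpow_mul, mul_comm, zpow_mul, zpow_natCast, hw.pow_eq_one, one_zpow]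
  rw [this]; simp

lemma flam_main (p : ℕ) (hp : 3 ≤ p) (w : ℂ) (hw : IsPrimitiveRoot w p) (z : ℂ)
    (hz : (z ^ p).im ≠ 0)
    (h1 : ∑ k ∈ Finset.range p, (w ^ k * z) * Complex.exp (w ^ k * z) = 0) : False := by
  have hp0 : p ≠ 0 := by lia
  have hz0 : z ≠ 0 := by
    rintro rfl; simp [hp0] at hz
  have hc0 : ∀ k, w ^ k * z ≠ 0 := fun k => mul_ne_zero (pow_ne_zero _ (hw.ne_zero hp0)) hz0
  have hcp : ∀ k, (w ^ k * z) ^ p = z ^ p := fun k => by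
    rw [mul_pow, ← pow_mul, mul_comm k, pow_mul, hw.pow_eq_one, one_pow, one_mul]
  set v : ℤ → ℝ → ℂ := fun r t =>
    ∑ k ∈ Finset.range p, (w ^ k * z) ^ (-r) * Complex.exp ((w ^ k * z) * t) with hv
  have hshift : ∀ k (r : ℤ), (w ^ k * z) ^ (-(r - 1)) = (w ^ k * z) ^ (-r) * (w ^ k * z) := by
    intro k r
    rw [← zpow_add_one₀ (hc0 k)]; congr 1; ring
  have hshiftp : ∀ k (r : ℤ), (w ^ k * z) ^ (-(r - p)) = z ^ p * (w ^ k * z) ^ (-r) := by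
    intro k r
    rw [← hcp k, ← zpow_natCast (w ^ k * z) p, ← zpow_add₀ (hc0 k)]; congr 1; ring
  have hder : ∀ r t, HasDerivAt (v r) (v (r - 1) t) t := by
    intro r t
    simp only [hv]
    apply HasDerivAt.fun_sum
    intro k _
    rw [hshift]
    have h2 : HasDerivAt (fun x : ℂ => Complex.exp ((w ^ k * z) * x))
        (Complex.exp ((w ^ k * z) * t) * ((w ^ k * z) * 1)) (t : ℂ) :=
      ((hasDerivAt_id (t : ℂ)).const_mul _).cexp
    have h3 := h2.comp_ofReal.const_mul ((w ^ k * z) ^ (-r))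
    exact h3.congr_deriv (by ring)
  have hper : ∀ r t, v (r - p) t = z ^ p * v r t := by
    intro r t
    simp only [hv, Finset.mul_sum]
    refine Finset.sum_congr rfl fun k _ => ?_
    rw [hshiftp, mul_assoc]
  have hv0 : ∀ r : ℤ, ¬ (p : ℤ) ∣ r → v r 0 = 0 := by
    intro r hr
    simpa [hv] using flam_sum_zero p w hw r hr z
  have hnd : ∀ r s : ℤ, r < s → s < r + p → ¬ (p : ℤ) ∣ r ∨ ¬ (p : ℤ) ∣ s := by
    intro r s a b
    by_contra! hcon
    have := Int.le_of_dvd (by lia) (dvd_sub hcon.2 hcon.1)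
    lia
  have hpos : ∀ t : ℝ, 0 ≤ t → ∀ r s : ℤ, r ≤ s → s ≤ r + p →
      0 ≤ (z ^ p).im * (v r t * (starRingEnd ℂ) (v s t)).im := by
    intro t ht r s a b
    let u : ℕ → ℤ → ℂ := fun n r =>
      ∑ k ∈ Finset.range p, (w ^ k * z) ^ (-r) * (1 + ((w ^ k * z) * t) / n) ^ n
    have hu : ∀ r, Filter.Tendsto (fun n => u n r) Filter.atTop (nhds (v r t)) := by
      intro r
      apply tendsto_finsetSum
      intro k _
      exact (Complex.tendsto_one_add_div_pow_exp _).const_mul _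
    have hlim : Filter.Tendsto (fun n => (z ^ p).im * (u n r * (starRingEnd ℂ) (u n s)).im)
        Filter.atTop (nhds ((z ^ p).im * (v r t * (starRingEnd ℂ) (v s t)).im)) := by
      apply Filter.Tendsto.const_mul
      exact (Complex.continuous_im.tendsto _).comp
        ((hu r).mul ((Complex.continuous_conj.tendsto _).comp (hu s)))
    refine ge_of_tendsto' hlim fun n => ?_
    refine flam_discrete p (z ^ p) (t / n) (by positivity)
      (fun m r => ∑ k ∈ Finset.range p, (w ^ k * z) ^ (-r) * (1 + ((w ^ k * z) * t) / n) ^ m)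
      ?_ ?_ ?_ n r s a b
    · intro m r
      simp only [Finset.mul_sum, ← Finset.sum_add_distrib]
      refine Finset.sum_congr rfl fun k _ => ?_
      rw [hshift, pow_succ]
      push_cast
      ring
    · intro m r
      simp only [Finset.mul_sum]
      refine Finset.sum_congr rfl fun k _ => ?_
      rw [hshiftp, mul_assoc]
    · intro r s a b
      simp only [pow_zero, mul_one]
      rcases hnd r s a b with h | h
      · rw [flam_sum_zero p w hw r h z]; simp
      · rw [flam_sum_zero p w hw s h z]; simp
  -- the vanishing at time one
  have hv1 : v (p - 1) 1 = 0 := by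
    have h2 : v (-1) 1 = 0 := by
      rw [← h1]; simp [hv]
    have h3 := hper (p - 1) 1
    rw [show (p : ℤ) - 1 - p = -1 by ring, h2] at h3
    rcases mul_eq_zero.1 h3.symm with h | h
    · exact absurd h (pow_ne_zero _ hz0)
    · exact h
  set g : ℝ → ℝ := fun t => (z ^ p).im * (v 0 t * (starRingEnd ℂ) (v (p - 1) t)).im with hg
  have hgd : ∀ t, HasDerivAt g ((z ^ p).im * (v (-1) t * (starRingEnd ℂ) (v (p - 1) t)).im
      + (z ^ p).im * (v 0 t * (starRingEnd ℂ) (v (p - 1 - 1) t)).im) t := by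
    intro t
    have d0 := hder 0 t
    have d1 := (hder (p - 1) t).star
    have d2 := (Complex.imCLM.hasFDerivAt.comp_hasDerivAt t (d0.mul d1)).const_mul (z ^ p).im
    rw [← mul_add, ← Complex.add_im]
    exact d2
  have hm1 : ∀ t, (z ^ p).im * (v (-1) t * (starRingEnd ℂ) (v (p - 1) t)).im
      = (z ^ p).im ^ 2 * Complex.normSq (v (p - 1) t) := by
    intro t
    have h3 := hper (p - 1) t
    rw [show (p : ℤ) - 1 - p = -1 by ring] at h3
    rw [h3, mul_assoc, Complex.mul_conj, Complex.im_mul_ofReal]; ring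
  have hmono : MonotoneOn g (Set.Icc 0 1) := by
    apply monotoneOn_of_deriv_nonneg (convex_Icc 0 1)
    · exact fun t _ => (hgd t).continuousAt.continuousWithinAt
    · exact fun t _ => (hgd t).differentiableAt.differentiableWithinAt
    · intro t ht
      rw [interior_Icc] at ht
      rw [(hgd t).deriv]
      exact add_nonneg (hpos t ht.1.le _ _ (by lia) (by lia)) (hpos t ht.1.le _ _ (by lia) (by lia))
  have hg0 : g 0 = 0 := by
    simp only [hg]
    rcases hnd 0 (p - 1) (by lia) (by lia) with h | h
    · simp at h
    · rw [hv0 _ h]; simp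
  have hg1 : g 1 = 0 := by
    simp only [hg]; rw [hv1]; simp
  have hgz : ∀ t ∈ Set.Icc (0 : ℝ) 1, g t = 0 := by
    intro t ht
    apply le_antisymm
    · rw [← hg1]; exact hmono ht (by simp) ht.2
    · rw [← hg0]; exact hmono (by simp) ht ht.1
  have hvz : ∀ t ∈ Set.Ioo (0 : ℝ) 1, v (p - 1) t = 0 := by
    intro t ht
    have he : g =ᶠ[nhds t] fun _ => 0 := by
      filter_upwards [Ioo_mem_nhds ht.1 ht.2] with x hx
      exact hgz x ⟨hx.1.le, hx.2.le⟩
    have h2 := (hgd t).unique ((hasDerivAt_const t (0 : ℝ)).congr_of_eventuallyEq he)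
    have h3 := hpos t ht.1.le 0 (p - 1 - 1) (by lia) (by lia)
    rw [hm1] at h2
    have h4 : 0 < (z ^ p).im ^ 2 := by positivity
    have h5 : Complex.normSq (v (p - 1) t) = 0 := by
      have := Complex.normSq_nonneg (v (p - 1) t)
      nlinarith
    exact Complex.normSq_eq_zero.1 h5
  have hall : ∀ n : ℕ, ∀ t ∈ Set.Ioo (0 : ℝ) 1, v (p - 1 - n) t = 0 := by
    intro n
    induction n with
    | zero => simpa using hvz
    | succ n ih =>
      intro t ht
      have he : v (p - 1 - n) =ᶠ[nhds t] fun _ => 0 := by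
        filter_upwards [Ioo_mem_nhds ht.1 ht.2] with x hx
        exact ih x hx
      have h2 := (hder (p - 1 - n) t).unique
        ((hasDerivAt_const t (0 : ℂ)).congr_of_eventuallyEq he)
      rw [← h2]; congr 1; push_cast; ring
  have h00 : ∀ t ∈ Set.Ioo (0 : ℝ) 1, v 0 t = 0 := by
    intro t ht
    have := hall (p - 1) t ht
    rwa [show (p : ℤ) - 1 - ((p - 1 : ℕ) : ℤ) = 0 by lia] at this
  have hlim : Filter.Tendsto (v 0) (nhdsWithin 0 (Set.Ioi 0)) (nhds (v 0 0)) :=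
    (hder 0 0).continuousAt.tendsto.mono_left nhdsWithin_le_nhds
  have hlim2 : Filter.Tendsto (v 0) (nhdsWithin 0 (Set.Ioi 0)) (nhds 0) := by
    apply tendsto_const_nhds.congr'
    filter_upwards [Ioo_mem_nhdsGT (show (0 : ℝ) < 1 by norm_num)] with x hx
    exact (h00 x hx).symm
  have h6 := tendsto_nhds_unique hlim hlim2
  simp [hv, hp0] at h6

lemma flam_real (p : ℕ) (hp : 3 ≤ p) (w : ℂ) (hw : IsPrimitiveRoot w p) (z : ℂ)
    (hz : (z ^ p).im = 0) : (∑ k ∈ Finset.range p, Complex.exp (w ^ k * z)).im = 0 := by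
  have hp0 : 0 < p := by lia
  rcases eq_or_ne z 0 with rfl | hz0
  · simp
  have himg : (Finset.range p).image (fun k => w ^ k) = Polynomial.nthRootsFinset p (1 : ℂ) := by
    apply Finset.eq_of_subset_of_card_le
    · intro x hx
      obtain ⟨k, _, rfl⟩ := Finset.mem_image.1 hx
      rw [Polynomial.mem_nthRootsFinset hp0, ← pow_mul, mul_comm, pow_mul, hw.pow_eq_one, one_pow]
    · rw [hw.card_nthRootsFinset, Finset.card_image_of_injOn, Finset.card_range]
      intro a ha b hb hab
      exact hw.pow_inj (by simpa using ha) (by simpa using hb) hab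
  have hsum : ∑ k ∈ Finset.range p, Complex.exp (w ^ k * z)
      = ∑ x ∈ Polynomial.nthRootsFinset p (1 : ℂ), Complex.exp (x * z) := by
    rw [← himg, Finset.sum_image]
    intro a ha b hb hab
    exact hw.pow_inj (by simpa using ha) (by simpa using hb) hab
  rw [hsum, ← Complex.conj_eq_iff_im, map_sum]
  have hcz : (starRingEnd ℂ) z ^ p = z ^ p := by
    rw [← map_pow]; exact Complex.conj_eq_iff_im.2 hz
  have hcz0 : (starRingEnd ℂ) z ≠ 0 := by simpa using hz0
  have hmem : ∀ x ∈ Polynomial.nthRootsFinset p (1 : ℂ),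
      (starRingEnd ℂ) x * ((starRingEnd ℂ) z / z) ∈ Polynomial.nthRootsFinset p (1 : ℂ) := by
    intro x hx
    rw [Polynomial.mem_nthRootsFinset hp0] at hx ⊢
    rw [mul_pow, div_pow, hcz, div_self (pow_ne_zero _ hz0), ← map_pow, hx]; simp
  refine Finset.sum_bij' (fun x _ => (starRingEnd ℂ) x * ((starRingEnd ℂ) z / z))
    (fun x _ => (starRingEnd ℂ) x * ((starRingEnd ℂ) z / z)) hmem hmem ?_ ?_ ?_
  · intro x _
    simp only [map_mul, map_div₀, Complex.conj_conj]
    field_simp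
  · intro x _
    simp only [map_mul, map_div₀, Complex.conj_conj]
    field_simp
  · intro x _
    rw [← Complex.exp_conj, map_mul]
    congr 1
    field_simp

theorem f_lambda_critical_values_real (p : ℕ) (hp : 3 ≤ p) (lam : ℝ) (hlam : lam ≠ 0)
    (f : ℂ → ℂ)
    (hf : ∀ z : ℂ, f z = lam * ∑ k ∈ Finset.range p,
      Complex.exp ((Complex.exp (2 * Real.pi * Complex.I / p)) ^ k * z))
    (z : ℂ) (hz : deriv f z = 0) : (f z).im = 0 := by
  have hw := Complex.isPrimitiveRoot_exp p (by lia)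
  set w := Complex.exp (2 * Real.pi * Complex.I / p) with hwdef
  have hd : HasDerivAt f (lam * ∑ k ∈ Finset.range p, Complex.exp (w ^ k * z) * (w ^ k * 1)) z := by
    rw [funext hf]
    apply HasDerivAt.const_mul
    apply HasDerivAt.fun_sum
    intro k _
    exact ((hasDerivAt_id z).const_mul _).cexp
  rw [hd.deriv] at hz
  have hz' := (mul_eq_zero.1 hz).resolve_left (by exact_mod_cast hlam)
  rw [hf, Complex.im_ofReal_mul]
  by_cases him : (z ^ p).im = 0
  · rw [flam_real p hp w hw z him, mul_zero]
  · exfalso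
    apply flam_main p hp w hw z him
    calc _ = z * ∑ k ∈ Finset.range p, Complex.exp (w ^ k * z) * (w ^ k * 1) := by
          rw [Finset.mul_sum]
          exact Finset.sum_congr rfl fun k _ => by ring
      _ = 0 := by rw [hz', mul_zero]
end
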